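/- arXiv:2507.20572 — 2 statements merged into one kernel-verified Lean document; each statement's English description precedes it below -/
import Mathlib

section
/- Let K be a field and let 𝒜 be a non-unital, not necessarily associative algebra over K with elements e, f, g ∈ 𝒜 and scalars i, j, k ∈ K satisfying e·e = i•e, f·f = j•f, g·g = k•g. Set A = e·f, B = e·g, C = f·e, D = f·g, E = g·e, F = g·f. If (x·y)·(x·y) = (x·x)·(y·y) holds for all x, y ∈ 𝒜, then the three equations of condition (17) hold: B·C + B·A + E·C − A·E = i•(e·F + F·e); D·A + F·A + D·C − C·F = j•(E·f + f·E); D·B + F·B + F·E − E·D = k•(C·g + g·C). -/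
/-- Polarization of the endo-commutativity identity in its right argument. -/
theorem endoCommutative_polarize_right {R : Type*} [NonUnitalNonAssocRing R]
    (hec : ∀ x y : R, (x * y) * (x * y) = (x * x) * (y * y)) (x y z : R) :
    (x * y) * (x * z) + (x * z) * (x * y) = (x * x) * (y * z) + (x * x) * (z * y) := by
  have h := hec x (y + z)
  simp only [mul_add, add_mul] at h
  linear_combination (norm := abel) h - hec x y - hec x z

/-- Polarization of the endo-commutativity identity in its left argument. -/
theorem endoCommutative_polarize_left {R : Type*} [NonUnitalNonAssocRing R]
    (hec : ∀ x y : R, (x * y) * (x * y) = (x * x) * (y * y)) (x y z : R) :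
    (y * x) * (z * x) + (z * x) * (y * x) = (y * z) * (x * x) + (z * y) * (x * x) := by
  have h := hec (y + z) x
  simp only [mul_add, add_mul] at h
  linear_combination (norm := abel) h - hec y x - hec z x

/-- Polarization of the endo-commutativity identity in both arguments. -/
theorem endoCommutative_polarize {R : Type*} [NonUnitalNonAssocRing R]
    (hec : ∀ x y : R, (x * y) * (x * y) = (x * x) * (y * y)) (x w y z : R) :
    (x * y) * (w * z) + (w * z) * (x * y) + (x * z) * (w * y) + (w * y) * (x * z) =
      (x * w + w * x) * (y * z + z * y) := by
  have h := endoCommutative_polarize_right hec (x + w) y z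
  have hx := endoCommutative_polarize_right hec x y z
  have hw := endoCommutative_polarize_right hec w y z
  simp only [mul_add, add_mul] at h ⊢
  linear_combination (norm := abel) h - hx - hw

/-- The component of the polarized endo-commutativity identity that is quadratic in `e` and
linear in `f` and `g`. -/
theorem endoCommutative_quadratic_component {R : Type*} [NonUnitalNonAssocRing R]
    (hec : ∀ x y : R, (x * y) * (x * y) = (x * x) * (y * y)) (e f g : R) :
    (e * g) * (f * e) + (e * g) * (e * f) + (g * e) * (f * e) - (e * f) * (g * e) =
      (e * e) * (g * f) + (g * f) * (e * e) := by
  have h := endoCommutative_polarize hec e f e g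
  have hr := endoCommutative_polarize_right hec e f g
  have hl := endoCommutative_polarize_left hec e f g
  simp only [mul_add, add_mul] at h
  linear_combination (norm := abel) h + hr + hl

/-- If an endo-commutative non-unital nonassociative algebra over a field
satisfies `e·e = i•e`, `f·f = j•f`, `g·g = k•g`, then the three equations of
condition (17) hold. -/
theorem condition_seventeen_of_endoCommutative
    (K : Type*) [Field K] (𝒜 : Type*) [NonUnitalNonAssocRing 𝒜]
    [Module K 𝒜] [SMulCommClass K 𝒜 𝒜] [IsScalarTower K 𝒜 𝒜]
    (e f g : 𝒜) (i j k : K)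
    (he : e * e = i • e) (hf : f * f = j • f) (hg : g * g = k • g)
    (A B C D E F : 𝒜)
    (hA : A = e * f) (hB : B = e * g) (hC : C = f * e)
    (hD : D = f * g) (hE : E = g * e) (hF : F = g * f)
    (hec : ∀ x y : 𝒜, (x * y) * (x * y) = (x * x) * (y * y)) :
    B * C + B * A + E * C - A * E = i • (e * F + F * e) ∧
    D * A + F * A + D * C - C * F = j • (E * f + f * E) ∧
    D * B + F * B + F * E - E * D = k • (C * g + g * C) := by
  subst hA hB hC hD hE hF
  have h₁ := endoCommutative_quadratic_component hec e f g
  have h₂ := endoCommutative_quadratic_component hec f e g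
  have h₃ := endoCommutative_quadratic_component hec g e f
  simp only [he, hf, hg, smul_mul_assoc, mul_smul_comm, ← smul_add] at h₁ h₂ h₃
  refine ⟨h₁, ?_, ?_⟩
  · rw [add_comm (g * e * f), ← h₂]
    abel
  · rw [add_comm (f * e * g), ← h₃]
    abel
end

section
/- Let K be a field and let 𝒜 be a non-unital, not necessarily associative algebra over K with elements e, f, g ∈ 𝒜 and scalars i, j, k ∈ K satisfying e·e = i•e, f·f = j•f, g·g = k•g. Set A = e·f, B = e·g, C = f·e, D = f·g, E = g·e, F = g·f. If (x·y)·(x·y) = (x·x)·(y·y) holds for all x, y ∈ 𝒜, then: A·A = (i*j)•A; B·B = (i*k)•B; A·B + B·A = i•(e·(D+F)); i•(A·e) = i•(e·C); and i•(B·e) = i•(e·E). -/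
/-- Polarization in the second variable of the endo-commutativity identity. -/
theorem endoCommutative_polarization {R : Type*} [NonUnitalNonAssocRing R]
    (hec : ∀ x y : R, (x * y) * (x * y) = (x * x) * (y * y)) (x y z : R) :
    (x * y) * (x * z) + (x * z) * (x * y) = (x * x) * (y * z + z * y) := by
  have h := hec x (y + z)
  simp only [mul_add, add_mul, hec x y, hec x z] at h ⊢
  rw [← sub_eq_zero] at h ⊢
  rw [← h]
  abel

/-- The five equations obtained by substituting x = e into the endo-commutativity identity (equation (4)). -/
theorem eq_system_four
    (K : Type*) [Field K] (𝒜 : Type*) [NonUnitalNonAssocRing 𝒜]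
    [Module K 𝒜] [SMulCommClass K 𝒜 𝒜] [IsScalarTower K 𝒜 𝒜]
    (e f g : 𝒜) (i j k : K)
    (he : e * e = i • e) (hf : f * f = j • f) (hg : g * g = k • g)
    (A B C D E F : 𝒜)
    (hA : A = e * f) (hB : B = e * g) (hC : C = f * e)
    (hD : D = f * g) (hE : E = g * e) (hF : F = g * f)
    (hec : ∀ x y : 𝒜, (x * y) * (x * y) = (x * x) * (y * y)) :
    A * A = (i * j) • A ∧
    B * B = (i * k) • B ∧
    A * B + B * A = i • (e * (D + F)) ∧
    i • (A * e) = i • (e * C) ∧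
    i • (B * e) = i • (e * E) := by
  subst hA hB hC hD hE hF
  have square (y : 𝒜) (m : K) (hy : y * y = m • y) :
      (e * y) * (e * y) = (i * m) • (e * y) := by
    rw [hec, he, hy, smul_mul_assoc, mul_smul_comm, smul_smul]
  have commute (y : 𝒜) : i • ((e * y) * e) = i • (e * (y * e)) := by
    have h := endoCommutative_polarization hec e e y
    simp only [he, smul_mul_assoc, mul_smul_comm, mul_add] at h
    exact add_left_cancel h
  refine ⟨square f j hf, square g k hg, ?_, commute f, commute g⟩
  rw [endoCommutative_polarization hec, he, smul_mul_assoc]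
end
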